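/- arXiv:1503.07102 — 4 statements merged into one kernel-verified Lean document; each statement's English description precedes it below -/
import Mathlib

section
/- In the normal linear regression model y = Xβ + ε with ε ~ N_n(0, σ²V), the integral of the likelihood over β ∈ R^p (the marginal likelihood under the improper uniform prior on β) equals the residual likelihood: ∫_{R^p} f(y|β,σ²) dβ = (2πσ²)^{−(n−p)/2} |V|^{−1/2} |X^t V^{−1} X|^{−1/2} exp{ −y^t P y/(2σ²) }, where P = V^{−1} − V^{−1} X (X^t V^{−1} X)^{−1} X^t V^{−1}. -/
open MeasureTheory Matrix Real Filter

/-- Density of the `n`-variate normal distribution with mean vector `μ` and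
covariance matrix `S`, with respect to the Lebesgue measure on `Fin n → ℝ`. -/
noncomputable def gaussPdf {n : ℕ} (μ : Fin n → ℝ) (S : Matrix (Fin n) (Fin n) ℝ)
    (x : Fin n → ℝ) : ℝ :=
  ((2 * π) ^ n * S.det) ^ (-(1 : ℝ) / 2) *
    Real.exp (-((x - μ) ⬝ᵥ S⁻¹.mulVec (x - μ)) / 2)

/-- Change of variables `x ↦ M x` in a Lebesgue integral over `Fin p → ℝ`. -/
lemma integral_comp_mulVec {p : ℕ} {M : Matrix (Fin p) (Fin p) ℝ} (hM : M.det ≠ 0)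
    (g : (Fin p → ℝ) → ℝ) :
    ∫ x, g (M *ᵥ x) = |M.det|⁻¹ * ∫ x, g x := by
  let e := Matrix.toLinearEquiv' M (M.invertibleOfIsUnitDet (Ne.isUnit hM))
  have hmap := Real.map_matrix_volume_pi_eq_smul_volume_pi hM
  have hemb : MeasurableEmbedding (Matrix.toLin' M) :=
    e.toContinuousLinearEquiv.toHomeomorph.measurableEmbedding
  have h := hemb.integral_map (μ := volume) g
  rw [hmap, integral_smul_measure, ENNReal.toReal_ofReal (abs_nonneg _), abs_inv] at h
  simpa using h.symm

open scoped MatrixOrder in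
/-- A real positive definite matrix is `Bᵀ * B` for a square matrix `B`. -/
lemma Matrix.PosDef.exists_eq_transpose_mul_self {p : ℕ} {A : Matrix (Fin p) (Fin p) ℝ}
    (hA : A.PosDef) : ∃ B : Matrix (Fin p) (Fin p) ℝ, A = Bᵀ * B := by
  obtain ⟨B, hB⟩ := CStarAlgebra.nonneg_iff_eq_star_mul_self.mp
    (Matrix.nonneg_iff_posSemidef.mpr hA.posSemidef)
  exact ⟨B, by rw [hB, Matrix.star_eq_conjTranspose, Matrix.conjTranspose_eq_transpose_of_trivial]⟩

lemma integral_exp_neg_dotProduct_self {p : ℕ} {c : ℝ} (hc : 0 < c) :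
    ∫ x : Fin p → ℝ, Real.exp (-(x ⬝ᵥ x) / (2 * c)) = (2 * π * c) ^ ((p : ℝ) / 2) := by
  have h : ∀ x : Fin p → ℝ, Real.exp (-(x ⬝ᵥ x) / (2 * c))
      = ∏ i, Real.exp (-(1 / (2 * c)) * x i ^ 2) := by
    intro x
    rw [← Real.exp_sum, dotProduct, ← Finset.mul_sum]
    congr 1
    simp_rw [sq]
    ring
  simp_rw [h]
  rw [integral_fintype_prod_volume_eq_pow (fun t : ℝ => Real.exp (-(1 / (2 * c)) * t ^ 2)),
    integral_gaussian, Fintype.card_fin, Real.sqrt_eq_rpow, ← Real.rpow_natCast,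
    ← Real.rpow_mul (by positivity)]
  congr 1
  · field_simp
  · ring

/-- The multivariate Gaussian integral. -/
lemma Matrix.PosDef.integral_exp_neg_quadratic {p : ℕ} {A : Matrix (Fin p) (Fin p) ℝ}
    (hA : A.PosDef) {c : ℝ} (hc : 0 < c) :
    ∫ x : Fin p → ℝ, Real.exp (-(x ⬝ᵥ A *ᵥ x) / (2 * c))
      = (2 * π * c) ^ ((p : ℝ) / 2) * A.det ^ (-(1 : ℝ) / 2) := by
  obtain ⟨B, rfl⟩ := hA.exists_eq_transpose_mul_self
  have hdet : (Bᵀ * B).det = |B.det| ^ 2 := by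
    rw [Matrix.det_mul, Matrix.det_transpose, sq_abs, sq]
  have hB : B.det ≠ 0 := by
    intro h
    have := hA.det_pos
    simp [hdet, h] at this
  have hq : ∀ x : Fin p → ℝ, x ⬝ᵥ (Bᵀ * B) *ᵥ x = (B *ᵥ x) ⬝ᵥ (B *ᵥ x) := by
    intro x
    rw [← Matrix.mulVec_mulVec, Matrix.dotProduct_mulVec, Matrix.vecMul_transpose]
  simp_rw [hq]
  rw [integral_comp_mulVec hB (fun x => Real.exp (-(x ⬝ᵥ x) / (2 * c))),
    integral_exp_neg_dotProduct_self hc, hdet, ← Real.rpow_natCast,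
    ← Real.rpow_mul (abs_nonneg _), mul_comm]
  congr 1
  rw [← Real.rpow_neg_one]
  norm_num

/-- A matrix of full column rank acts injectively on vectors. -/
lemma Matrix.mulVec_injective_of_rank_eq {n p : ℕ} {X : Matrix (Fin n) (Fin p) ℝ}
    (hX : X.rank = p) : Function.Injective X.mulVec := by
  rw [Matrix.mulVec_injective_iff, linearIndependent_iff_card_eq_finrank_span, Set.finrank,
    ← Matrix.rank_eq_finrank_span_cols, hX, Fintype.card_fin]

/-- Completing the square in generalized least squares with weight matrix `W`. -/
lemma weighted_residual_eq_add {n p : ℕ} {X : Matrix (Fin n) (Fin p) ℝ}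
    {W : Matrix (Fin n) (Fin n) ℝ} (hW : Wᵀ = W) (hA : IsUnit (Xᵀ * W * X).det)
    (y : Fin n → ℝ) (β : Fin p → ℝ) :
    (y - X *ᵥ β) ⬝ᵥ W *ᵥ (y - X *ᵥ β)
      = y ⬝ᵥ (W - W * X * (Xᵀ * W * X)⁻¹ * Xᵀ * W) *ᵥ y
        + (β - ((Xᵀ * W * X)⁻¹ * Xᵀ * W) *ᵥ y) ⬝ᵥ
          (Xᵀ * W * X) *ᵥ (β - ((Xᵀ * W * X)⁻¹ * Xᵀ * W) *ᵥ y) := by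
  set A := Xᵀ * W * X with hAdef
  set b := (A⁻¹ * Xᵀ * W) *ᵥ y with hb
  have hAt : Aᵀ = A := by
    simp [hAdef, Matrix.transpose_mul, hW, Matrix.mul_assoc]
  have hsymm : ∀ {m : ℕ} {S : Matrix (Fin m) (Fin m) ℝ}, Sᵀ = S → ∀ u v : Fin m → ℝ,
      u ⬝ᵥ S *ᵥ v = v ⬝ᵥ S *ᵥ u := by
    intro m S hS u v
    rw [Matrix.dotProduct_mulVec, ← Matrix.mulVec_transpose, hS, dotProduct_comm]
  have hX : ∀ (u : Fin p → ℝ) (v : Fin n → ℝ), (X *ᵥ u) ⬝ᵥ v = u ⬝ᵥ Xᵀ *ᵥ v := by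
    intro u v
    rw [Matrix.dotProduct_mulVec, Matrix.vecMul_transpose]
  have hAb : A *ᵥ b = Xᵀ *ᵥ W *ᵥ y := by
    rw [hb, Matrix.mulVec_mulVec, ← Matrix.mul_assoc, ← Matrix.mul_assoc,
      Matrix.mul_nonsing_inv A hA, Matrix.one_mul, Matrix.mulVec_mulVec]
  have hquad : (X *ᵥ β) ⬝ᵥ W *ᵥ X *ᵥ β = β ⬝ᵥ A *ᵥ β := by
    rw [hX, Matrix.mulVec_mulVec, Matrix.mulVec_mulVec, hAdef, Matrix.mul_assoc]
  have hcross : (X *ᵥ β) ⬝ᵥ W *ᵥ y = β ⬝ᵥ A *ᵥ b := by rw [hX, hAb]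
  have hfit : y ⬝ᵥ (W * X * A⁻¹ * Xᵀ * W) *ᵥ y = b ⬝ᵥ A *ᵥ b := by
    have h : (W * X * A⁻¹ * Xᵀ * W) *ᵥ y = W *ᵥ X *ᵥ b := by
      simp [hb, Matrix.mulVec_mulVec, Matrix.mul_assoc]
    rw [h, hsymm hW, hX, hAb]
  rw [Matrix.sub_mulVec, dotProduct_sub, hfit]
  simp only [Matrix.mulVec_sub, dotProduct_sub, sub_dotProduct]
  rw [hsymm hW y (X *ᵥ β), hquad, hcross, hsymm hAt b β]
  ring

/-- In the model `y = Xβ + ε`, `ε ~ N_n(0, σ²V)`, the integral of the likelihood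
over `β ∈ ℝᵖ` (marginal likelihood under the improper uniform prior) equals the
residual likelihood
`(2πσ²)^{-(n-p)/2} |V|^{-1/2} |XᵀV⁻¹X|^{-1/2} exp(-yᵀPy/(2σ²))`,
where `P = V⁻¹ - V⁻¹X(XᵀV⁻¹X)⁻¹XᵀV⁻¹`. -/
theorem stmt_3 (n p : ℕ) (hpn : p < n) (X : Matrix (Fin n) (Fin p) ℝ)
    (hX : X.rank = p) (V : Matrix (Fin n) (Fin n) ℝ) (hV : V.PosDef)
    (σ2 : ℝ) (hσ : 0 < σ2)
    (P : Matrix (Fin n) (Fin n) ℝ)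
    (hP : P = V⁻¹ - V⁻¹ * X * (Xᵀ * V⁻¹ * X)⁻¹ * Xᵀ * V⁻¹)
    (y : Fin n → ℝ) :
    (∫ β : Fin p → ℝ, gaussPdf (X.mulVec β) (σ2 • V) y)
      = (2 * π * σ2) ^ (-((n : ℝ) - p) / 2) * V.det ^ (-(1 : ℝ) / 2) *
          (Xᵀ * V⁻¹ * X).det ^ (-(1 : ℝ) / 2) *
          Real.exp (-(y ⬝ᵥ P.mulVec y) / (2 * σ2)) := by
  have hW : (V⁻¹)ᵀ = V⁻¹ := by
    simpa [Matrix.IsHermitian] using hV.inv.isHermitian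
  have hA : (Xᵀ * V⁻¹ * X).PosDef := by
    simpa using hV.inv.conjTranspose_mul_mul_same (Matrix.mulVec_injective_of_rank_eq hX)
  have hinv : (σ2 • V)⁻¹ = σ2⁻¹ • V⁻¹ :=
    Matrix.inv_smul' V (Units.mk0 σ2 hσ.ne') hV.det_pos.ne'.isUnit
  set A := Xᵀ * V⁻¹ * X with hAdef
  set b := (A⁻¹ * Xᵀ * V⁻¹) *ᵥ y
  have hpdf : ∀ β : Fin p → ℝ, gaussPdf (X *ᵥ β) (σ2 • V) y
      = ((2 * π) ^ n * (σ2 • V).det) ^ (-(1 : ℝ) / 2) * Real.exp (-(y ⬝ᵥ P *ᵥ y) / (2 * σ2)) *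
        Real.exp (-((β - b) ⬝ᵥ A *ᵥ (β - b)) / (2 * σ2)) := by
    intro β
    rw [gaussPdf, hinv, Matrix.smul_mulVec, dotProduct_smul,
      weighted_residual_eq_add hW hA.det_pos.ne'.isUnit, ← hAdef, ← hP, mul_assoc, ← Real.exp_add]
    congr 2
    rw [smul_eq_mul]
    field_simp
    ring
  have hconst : ((2 * π) ^ n * (σ2 • V).det) ^ (-(1 : ℝ) / 2)
      = (2 * π * σ2) ^ (-(n : ℝ) / 2) * V.det ^ (-(1 : ℝ) / 2) := by
    rw [Matrix.det_smul, Fintype.card_fin, ← mul_assoc, ← mul_pow,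
      Real.mul_rpow (by positivity) hV.det_pos.le, ← Real.rpow_natCast,
      ← Real.rpow_mul (by positivity)]
    congr 2
    ring
  simp_rw [hpdf]
  rw [integral_const_mul,
    integral_sub_right_eq_self (fun β => Real.exp (-(β ⬝ᵥ A *ᵥ β) / (2 * σ2))) b,
    hA.integral_exp_neg_quadratic hσ, hconst,
    show -((n : ℝ) - p) / 2 = -(n : ℝ) / 2 + (p : ℝ) / 2 by ring, Real.rpow_add (by positivity)]
  ring
end

section
/- Let V be an n×n positive definite matrix, W a p×p positive definite matrix, and X an n×p matrix of rank p. Let A = (V + X W X^t)^{−1} and P = V^{−1} − V^{−1} X (X^t V^{−1} X)^{−1} X^t V^{−1}. Then tr(A V P V) = n − p. -/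
open Matrix

namespace Matrix

theorem mulVec_injective_of_rank_eq_card {m n K : Type*} [Fintype n] [Field K]
    {X : Matrix m n K} (hX : X.rank = Fintype.card n) : Function.Injective X.mulVec := by
  rw [mulVec_injective_iff, linearIndependent_iff_card_eq_finrank_span, ← hX,
    rank_eq_finrank_span_cols]
  rfl

end Matrix

/-- For positive definite `V` (n×n), positive definite `W` (p×p) and `X` (n×p) of
rank `p`, with `A = (V + XWXᵀ)⁻¹` and `P = V⁻¹ - V⁻¹X(XᵀV⁻¹X)⁻¹XᵀV⁻¹`,
one has `tr(A V P V) = n - p`. -/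
theorem stmt_4 (n p : ℕ) (hpn : p < n) (X : Matrix (Fin n) (Fin p) ℝ)
    (hX : X.rank = p) (V : Matrix (Fin n) (Fin n) ℝ) (hV : V.PosDef)
    (W : Matrix (Fin p) (Fin p) ℝ) (hW : W.PosDef)
    (A P : Matrix (Fin n) (Fin n) ℝ)
    (hA : A = (V + X * W * Xᵀ)⁻¹)
    (hP : P = V⁻¹ - V⁻¹ * X * (Xᵀ * V⁻¹ * X)⁻¹ * Xᵀ * V⁻¹) :
    (A * V * P * V).trace = (n : ℝ) - p := by
  have hinj : Function.Injective X.mulVec :=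
    mulVec_injective_of_rank_eq_card (by rw [hX, Fintype.card_fin])
  have hVu : IsUnit V.det := (isUnit_iff_isUnit_det V).mp hV.isUnit
  have hGu : IsUnit (Xᵀ * V⁻¹ * X).det := by
    have hG := hV.inv.conjTranspose_mul_mul_same hinj
    rw [conjTranspose_eq_transpose_of_trivial] at hG
    exact (isUnit_iff_isUnit_det _).mp hG.isUnit
  have hSu : IsUnit (V + X * W * Xᵀ).det := by
    have hB := hW.posSemidef.mul_mul_conjTranspose_same X
    rw [conjTranspose_eq_transpose_of_trivial] at hB
    exact (isUnit_iff_isUnit_det _).mp (hV.add_posSemidef hB).isUnit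
  have hXP : Xᵀ * P = 0 := by
    have h : Xᵀ * P = Xᵀ * V⁻¹ - (Xᵀ * V⁻¹ * X) * (Xᵀ * V⁻¹ * X)⁻¹ * (Xᵀ * V⁻¹) := by
      rw [hP]
      simp only [Matrix.mul_sub, Matrix.mul_assoc]
    rw [h, mul_nonsing_inv _ hGu, Matrix.one_mul, sub_self]
  have hAVP : A * V * P = P := by
    have h : V * P = (V + X * W * Xᵀ) * P := by
      rw [Matrix.add_mul, Matrix.mul_assoc _ Xᵀ P, hXP, Matrix.mul_zero, add_zero]
    rw [Matrix.mul_assoc, h, hA, nonsing_inv_mul_cancel_left _ _ hSu]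
  have hPV : P * V = 1 - V⁻¹ * X * ((Xᵀ * V⁻¹ * X)⁻¹ * Xᵀ) := by
    rw [hP, Matrix.sub_mul, nonsing_inv_mul_cancel_right _ _ hVu, nonsing_inv_mul _ hVu,
      Matrix.mul_assoc (V⁻¹ * X)]
  have htr : (V⁻¹ * X * ((Xᵀ * V⁻¹ * X)⁻¹ * Xᵀ)).trace = p := by
    rw [trace_mul_comm, Matrix.mul_assoc, ← Matrix.mul_assoc Xᵀ, nonsing_inv_mul _ hGu,
      trace_one, Fintype.card_fin]
  rw [hAVP, hPV, trace_sub, htr, trace_one, Fintype.card_fin]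
end

section
/- (Proposition 2) In the normal linear regression model y = Xβ + ε with ε ~ N_n(0, σ²V), let f_r(y|σ²) = (2πσ²)^{−(n−p)/2} |V|^{−1/2} |X^t V^{−1} X|^{−1/2} exp{−y^t P y/(2σ²)} be the residual likelihood, where P = V^{−1} − V^{−1} X (X^t V^{−1} X)^{−1} X^t V^{−1}, let σ̃² = y^t P y / (n − p) be the REML estimator, and let ỹ be an independent copy of y. Define I_r(ω) = E[ −2 log f_r(ỹ|σ̃²) ] and IC_r = −2 log f_r(y|σ̃²) + 2(n − p)/(n − p − 2). Then E(IC_r) = I_r(ω); equivalently, E[ ỹ^t P ỹ / σ̃² ] − (n − p) = 2(n − p)/(n − p − 2). -/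
open MeasureTheory Matrix Real Filter

/-- `-2 log f_r(y | s2)`, minus twice the log of the residual likelihood evaluated
at the variance value `s2`:
`(n-p) log(2π s2) + log|V| + log|Xᵀ V⁻¹ X| + yᵀ P y / s2`. -/
noncomputable def neg2logResid (n p : ℕ) (X : Matrix (Fin n) (Fin p) ℝ)
    (V : Matrix (Fin n) (Fin n) ℝ) (P : Matrix (Fin n) (Fin n) ℝ)
    (s2 : ℝ) (y : Fin n → ℝ) : ℝ :=
  ((n : ℝ) - p) * Real.log (2 * π * s2) + Real.log V.det
    + Real.log (Xᵀ * V⁻¹ * X).det + (y ⬝ᵥ P.mulVec y) / s2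

theorem Matrix.IsHermitian.exists_orthogonal_diagonalization {ι : Type*} [Fintype ι]
    [DecidableEq ι] {A : Matrix ι ι ℝ} (hA : A.IsHermitian) :
    ∃ (U : Matrix ι ι ℝ) (d : ι → ℝ), Uᵀ * U = 1 ∧ U * Uᵀ = 1 ∧ A = U * diagonal d * Uᵀ := by
  refine ⟨hA.eigenvectorUnitary, hA.eigenvalues, ?_, ?_, ?_⟩
  · simpa [star_eq_conjTranspose] using Unitary.coe_star_mul_self hA.eigenvectorUnitary
  · simpa [star_eq_conjTranspose] using Unitary.coe_mul_star_self hA.eigenvectorUnitary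
  · simpa [star_eq_conjTranspose, Unitary.conjStarAlgAut_apply] using hA.spectral_theorem

theorem Matrix.PosDef.exists_eq_mul_transpose {ι : Type*} [Fintype ι] [DecidableEq ι]
    {V : Matrix ι ι ℝ} (hV : V.PosDef) : ∃ A : Matrix ι ι ℝ, V = A * Aᵀ := by
  refine ⟨hV.1.eigenvectorUnitary * diagonal (fun i => √(hV.1.eigenvalues i)), ?_⟩
  have h : diagonal (fun i => √(hV.1.eigenvalues i)) * diagonal (fun i => √(hV.1.eigenvalues i))
      = diagonal hV.1.eigenvalues := by
    rw [diagonal_mul_diagonal]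
    congr 1
    funext i
    exact mul_self_sqrt (hV.eigenvalues_pos i).le
  have := hV.1.spectral_theorem
  rw [Unitary.conjStarAlgAut_apply] at this
  rw [transpose_mul, diagonal_transpose, Matrix.mul_assoc, ← Matrix.mul_assoc (diagonal _), h,
    ← Matrix.mul_assoc]
  simpa [star_eq_conjTranspose] using this

/-- Simultaneous diagonalization of a positive definite `V` and a symmetric `P` with
`P V P = P`. -/
theorem exists_simultaneous_diagonalization {ι : Type*} [Fintype ι] [DecidableEq ι]
    {V P : Matrix ι ι ℝ} (hV : V.PosDef) (hPt : Pᵀ = P) (hPVP : P * V * P = P) :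
    ∃ (B : Matrix ι ι ℝ) (d : ι → ℝ), V = B * Bᵀ ∧ Bᵀ * P * B = diagonal d ∧
      (∀ i, d i = 0 ∨ d i = 1) ∧ ∑ i, d i = (P * V).trace := by
  obtain ⟨A, rfl⟩ := hV.exists_eq_mul_transpose
  have hQ : (Aᵀ * P * A).IsHermitian := by
    rw [IsHermitian, conjTranspose_eq_transpose_of_trivial]
    simp [transpose_mul, hPt, Matrix.mul_assoc]
  obtain ⟨U, d, hU, hU', hd⟩ := hQ.exists_orthogonal_diagonalization
  have hD : (A * U)ᵀ * P * (A * U) = diagonal d := by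
    calc (A * U)ᵀ * P * (A * U) = Uᵀ * (Aᵀ * P * A) * U := by
          simp only [transpose_mul, Matrix.mul_assoc]
      _ = (Uᵀ * U) * diagonal d * (Uᵀ * U) := by rw [hd]; simp only [Matrix.mul_assoc]
      _ = diagonal d := by rw [hU, Matrix.one_mul, Matrix.mul_one]
  have hBB : A * Aᵀ = A * U * (A * U)ᵀ := by
    rw [transpose_mul, Matrix.mul_assoc, ← Matrix.mul_assoc U, hU', Matrix.one_mul]
  refine ⟨A * U, d, hBB, hD, fun i => ?_, ?_⟩
  · have h2 : diagonal d * diagonal d = diagonal d := by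
      calc diagonal d * diagonal d
          = (A * U)ᵀ * (P * (A * U * (A * U)ᵀ) * P) * (A * U) := by
            rw [← hD]; simp only [Matrix.mul_assoc]
        _ = diagonal d := by rw [← hBB, hPVP, hD]
    rw [diagonal_mul_diagonal] at h2
    have h3 := congrFun (diagonal_injective h2) i
    rcases eq_or_ne (d i) 0 with h | h
    · exact Or.inl h
    · exact Or.inr (mul_left_cancel₀ h (by rw [h3, mul_one]))
  · rw [← trace_diagonal, ← hD, hBB, Matrix.mul_assoc _ P, trace_mul_comm, Matrix.mul_assoc P]

theorem residual_projection_properties {n p : ℕ} {X : Matrix (Fin n) (Fin p) ℝ}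
    (hX : X.rank = p) {V P : Matrix (Fin n) (Fin n) ℝ} (hV : V.PosDef)
    (hP : P = V⁻¹ - V⁻¹ * X * (Xᵀ * V⁻¹ * X)⁻¹ * Xᵀ * V⁻¹) :
    Pᵀ = P ∧ P * V * P = P ∧ P * X = 0 ∧ (P * V).trace = (n : ℝ) - p := by
  have hXi : Function.Injective X.mulVec := by
    have h : LinearMap.ker X.mulVecLin = ⊥ := by
      have h1 := LinearMap.finrank_range_add_finrank_ker X.mulVecLin
      have h2 : Module.finrank ℝ (LinearMap.range X.mulVecLin) = p := hX
      rw [h2, Module.finrank_fin_fun] at h1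
      exact Submodule.finrank_eq_zero.mp (by omega)
    exact LinearMap.ker_eq_bot.mp h
  have hM : (Xᵀ * V⁻¹ * X).PosDef := by
    simpa using hV.inv.conjTranspose_mul_mul_same hXi
  have hVt : Vᵀ = V := by simpa using hV.1.eq
  have hVit : (V⁻¹)ᵀ = V⁻¹ := by rw [transpose_nonsing_inv, hVt]
  set M := Xᵀ * V⁻¹ * X with hMdef
  have hMt : (M⁻¹)ᵀ = M⁻¹ := by simpa using hM.inv.1.eq
  have hVdet : IsUnit V.det := (isUnit_iff_isUnit_det _).mp hV.isUnit
  have hMdet : IsUnit M.det := (isUnit_iff_isUnit_det _).mp hM.isUnit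
  have hPV : P * V = 1 - V⁻¹ * X * M⁻¹ * Xᵀ := by
    rw [hP, Matrix.sub_mul, nonsing_inv_mul _ hVdet, Matrix.mul_assoc _ V⁻¹ V,
      nonsing_inv_mul _ hVdet, Matrix.mul_one]
  have hPX : P * X = 0 := by
    have : V⁻¹ * X * M⁻¹ * Xᵀ * V⁻¹ * X = V⁻¹ * X * (M⁻¹ * M) := by
      rw [hMdef]; simp only [Matrix.mul_assoc]
    rw [hP, Matrix.sub_mul, this, nonsing_inv_mul _ hMdet, Matrix.mul_one, sub_self]
  have hPt : Pᵀ = P := by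
    rw [hP]
    simp only [transpose_sub, transpose_mul, transpose_transpose, hVit, hMt, Matrix.mul_assoc]
  have hXP : Xᵀ * P = 0 := by
    rw [← hPt, ← transpose_mul, hPX, transpose_zero]
  refine ⟨hPt, ?_, hPX, ?_⟩
  · rw [hPV, Matrix.sub_mul, Matrix.one_mul, Matrix.mul_assoc _ Xᵀ, hXP, Matrix.mul_zero, sub_zero]
  · have : (V⁻¹ * X * M⁻¹ * Xᵀ).trace = (p : ℝ) := by
      rw [trace_mul_comm, ← Matrix.mul_assoc, ← Matrix.mul_assoc, ← hMdef,
        mul_nonsing_inv _ hMdet, trace_one, Fintype.card_fin]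
    rw [hPV, trace_sub, trace_one, this, Fintype.card_fin]

open ProbabilityTheory in
theorem abs_det_mul_gaussPdf_affine {n : ℕ} (μ : Fin n → ℝ) {S C : Matrix (Fin n) (Fin n) ℝ}
    (hS : S = C * Cᵀ) (hC : C.det ≠ 0) (z : Fin n → ℝ) :
    |C.det| * gaussPdf μ S (C *ᵥ z + μ) = ∏ i, gaussianPDFReal 0 1 (z i) := by
  have hCu : IsUnit C.det := isUnit_iff_ne_zero.mpr hC
  have hCtu : IsUnit Cᵀ.det := by rwa [det_transpose]
  have hquad : (C *ᵥ z + μ - μ) ⬝ᵥ S⁻¹ *ᵥ (C *ᵥ z + μ - μ) = ∑ i, z i ^ 2 := by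
    rw [add_sub_cancel_right, hS, Matrix.mul_inv_rev, mulVec_mulVec, Matrix.mul_assoc,
      nonsing_inv_mul _ hCu, Matrix.mul_one, ← vecMul_transpose, ← dotProduct_mulVec,
      mulVec_mulVec, mul_nonsing_inv _ hCtu, one_mulVec]
    simp only [dotProduct, sq]
  have hpi : (0 : ℝ) < 2 * π := by positivity
  have hconst : |C.det| * ((2 * π) ^ n * S.det) ^ (-(1 : ℝ) / 2) = (√(2 * π))⁻¹ ^ n := by
    have h1 : (2 * π) ^ n * S.det = (√(2 * π) ^ n * |C.det|) ^ 2 := by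
      rw [hS, det_mul, det_transpose, mul_pow (√(2 * π) ^ n), ← pow_mul, mul_comm n 2, pow_mul,
        sq_sqrt hpi.le, sq_abs, sq C.det]
    have h2 : 0 < √(2 * π) ^ n * |C.det| := by positivity
    rw [h1, neg_div, rpow_neg (by positivity), ← sqrt_eq_rpow, sqrt_sq h2.le, mul_inv, inv_pow]
    field_simp
  unfold gaussPdf
  rw [hquad, ← mul_assoc, hconst]
  simp only [gaussianPDFReal, NNReal.coe_one, mul_one, sub_zero]
  rw [Finset.prod_mul_distrib, ← exp_sum, Finset.prod_const, Finset.card_univ, Fintype.card_fin,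
    ← Finset.sum_div, Finset.sum_neg_distrib]

open ProbabilityTheory in
/-- Integration against the density of `N_n(μ, C Cᵀ)` reduces to integration against the standard
Gaussian density. -/
theorem integral_mul_gaussPdf {n : ℕ} (μ : Fin n → ℝ) {S C : Matrix (Fin n) (Fin n) ℝ}
    (hS : S = C * Cᵀ) (hC : C.det ≠ 0) (F : (Fin n → ℝ) → ℝ) :
    (Integrable (fun z => F (C *ᵥ z + μ) * ∏ i, gaussianPDFReal 0 1 (z i)) →
      Integrable (fun y => F y * gaussPdf μ S y)) ∧
    ∫ y, F y * gaussPdf μ S y = ∫ z, F (C *ᵥ z + μ) * ∏ i, gaussianPDFReal 0 1 (z i) := by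
  have hCu : IsUnit C.det := isUnit_iff_ne_zero.mpr hC
  set L : (Fin n → ℝ) →L[ℝ] (Fin n → ℝ) := C.mulVecLin.toContinuousLinearMap with hL
  have hdet : L.det = C.det := by
    rw [hL, ContinuousLinearMap.det, LinearMap.coe_toContinuousLinearMap, ← toLin'_apply',
      LinearMap.det_toLin']
  have hder : ∀ x ∈ (Set.univ : Set (Fin n → ℝ)),
      HasFDerivWithinAt (fun z => C *ᵥ z + μ) L Set.univ x := fun x _ =>
    (L.hasFDerivAt.add_const μ).hasFDerivWithinAt
  have hinj : Function.Injective (fun z => C *ᵥ z + μ) := fun a b hab =>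
    mulVec_injective_iff_isUnit.mpr ((isUnit_iff_isUnit_det _).mpr hCu) (add_right_cancel hab)
  have himg : (fun z => C *ᵥ z + μ) '' Set.univ = Set.univ := by
    refine Set.eq_univ_of_forall fun y => ⟨C⁻¹ *ᵥ (y - μ), trivial, ?_⟩
    simp [mulVec_mulVec, mul_nonsing_inv _ hCu]
  have hfun : (fun z => |L.det| • (F (C *ᵥ z + μ) * gaussPdf μ S (C *ᵥ z + μ)))
      = fun z => F (C *ᵥ z + μ) * ∏ i, gaussianPDFReal 0 1 (z i) := by
    funext z
    rw [← abs_det_mul_gaussPdf_affine μ hS hC, hdet, smul_eq_mul]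
    ring
  constructor
  · intro h
    have := (integrableOn_image_iff_integrableOn_abs_det_fderiv_smul volume MeasurableSet.univ
      hder hinj.injOn (fun y => F y * gaussPdf μ S y)).mpr
    rw [himg, hfun, integrableOn_univ, integrableOn_univ] at this
    exact this h
  · have := integral_image_eq_integral_abs_det_fderiv_smul volume MeasurableSet.univ
      hder hinj.injOn (fun y => F y * gaussPdf μ S y)
    rwa [himg, hfun, setIntegral_univ, setIntegral_univ] at this

open ProbabilityTheory in
theorem integral_sq_mul_gaussianPDFReal :
    Integrable (fun x => x ^ 2 * gaussianPDFReal 0 1 x) ∧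
      ∫ x, x ^ 2 * gaussianPDFReal 0 1 x = 1 := by
  have hint : Integrable (fun x : ℝ => x ^ 2) (gaussianReal 0 1) :=
    (memLp_id_gaussianReal 2).integrable_sq
  have hvar : ∫ x, x ^ 2 ∂gaussianReal 0 1 = 1 := by
    have h := variance_fun_id_gaussianReal (μ := 0) (v := 1)
    rw [variance_eq_integral (by fun_prop)] at h
    simpa using h
  constructor
  · rw [gaussianReal_of_var_ne_zero _ one_ne_zero, integrable_withDensity_iff
      (measurable_gaussianPDF _ _) (by simp [gaussianPDF])] at hint
    simpa using hint
  · rw [integral_gaussianReal_eq_integral_smul one_ne_zero] at hvar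
    simpa [mul_comm] using hvar

open ProbabilityTheory in
theorem integral_exp_neg_mul_sq_mul_gaussianPDFReal {a : ℝ} (ha : 0 ≤ a) :
    Integrable (fun x => exp (-(a * x ^ 2)) * gaussianPDFReal 0 1 x) ∧
      ∫ x, exp (-(a * x ^ 2)) * gaussianPDFReal 0 1 x = (1 + 2 * a) ^ (-(1 : ℝ) / 2) := by
  have hfun : (fun x => exp (-(a * x ^ 2)) * gaussianPDFReal 0 1 x)
      = fun x => (√(2 * π))⁻¹ * exp (-(a + 1 / 2) * x ^ 2) := by
    funext x
    simp only [gaussianPDFReal, NNReal.coe_one, mul_one, sub_zero]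
    rw [mul_left_comm, ← exp_add]
    ring_nf
  rw [hfun]
  refine ⟨(integrable_exp_neg_mul_sq (by positivity)).const_mul _, ?_⟩
  rw [integral_const_mul, integral_gaussian, neg_div, rpow_neg (by positivity), ← sqrt_eq_rpow,
    ← sqrt_inv, ← sqrt_inv, ← sqrt_mul (by positivity)]
  congr 1
  field_simp
  ring

open ProbabilityTheory in
theorem integral_weighted_sq_mul_prod_gaussianPDFReal {n : ℕ} (d : Fin n → ℝ) :
    Integrable (fun z : Fin n → ℝ => (∑ i, d i * z i ^ 2) * ∏ i, gaussianPDFReal 0 1 (z i)) ∧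
      ∫ z : Fin n → ℝ, (∑ i, d i * z i ^ 2) * ∏ i, gaussianPDFReal 0 1 (z i) = ∑ i, d i := by
  have hterm : ∀ i : Fin n,
      Integrable (fun z : Fin n → ℝ => z i ^ 2 * ∏ j, gaussianPDFReal 0 1 (z j)) ∧
      ∫ z : Fin n → ℝ, z i ^ 2 * ∏ j, gaussianPDFReal 0 1 (z j) = 1 := by
    intro i
    set f : Fin n → ℝ → ℝ := fun j x => (if j = i then x ^ 2 else 1) * gaussianPDFReal 0 1 x
    have hf : ∀ j, Integrable (f j) ∧ ∫ x, f j x = 1 := by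
      intro j
      by_cases h : j = i
      · simpa [f, h] using integral_sq_mul_gaussianPDFReal
      · simpa [f, h] using
          And.intro (integrable_gaussianPDFReal 0 1) (integral_gaussianPDFReal_eq_one 0 one_ne_zero)
    have hfun : (fun z : Fin n → ℝ => z i ^ 2 * ∏ j, gaussianPDFReal 0 1 (z j))
        = fun z => ∏ j, f j (z j) := by
      funext z
      simp only [f]
      rw [Finset.prod_mul_distrib, Finset.prod_ite_eq' Finset.univ i (fun j => z j ^ 2),
        if_pos (Finset.mem_univ i)]
    rw [hfun, volume_pi]
    refine ⟨Integrable.fintype_prod fun j => (hf j).1, ?_⟩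
    rw [integral_fintype_prod_eq_prod]
    simp [(hf _).2]
  have hfun : (fun z : Fin n → ℝ => (∑ i, d i * z i ^ 2) * ∏ i, gaussianPDFReal 0 1 (z i))
      = fun z => ∑ i, d i * (z i ^ 2 * ∏ j, gaussianPDFReal 0 1 (z j)) := by
    funext z
    rw [Finset.sum_mul]
    simp only [mul_assoc]
  rw [hfun]
  have hi : ∀ i ∈ Finset.univ, Integrable
      (fun z : Fin n → ℝ => d i * (z i ^ 2 * ∏ j, gaussianPDFReal 0 1 (z j))) :=
    fun i _ => (hterm i).1.const_mul _
  refine ⟨integrable_finsetSum _ hi, ?_⟩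
  rw [integral_finsetSum _ hi]
  simp only [integral_const_mul, (hterm _).2, mul_one]

open ProbabilityTheory in
theorem integral_exp_neg_mul_prod_gaussianPDFReal {n : ℕ} {d : Fin n → ℝ}
    (hd : ∀ i, d i = 0 ∨ d i = 1) {t : ℝ} (ht : 0 ≤ t) :
    Integrable (fun z : Fin n → ℝ =>
      exp (-(t * ∑ i, d i * z i ^ 2)) * ∏ i, gaussianPDFReal 0 1 (z i)) ∧
    ∫ z : Fin n → ℝ, exp (-(t * ∑ i, d i * z i ^ 2)) * ∏ i, gaussianPDFReal 0 1 (z i)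
      = (1 + 2 * t) ^ (-(∑ i, d i) / 2) := by
  set f : Fin n → ℝ → ℝ := fun j x => exp (-(t * d j * x ^ 2)) * gaussianPDFReal 0 1 x
  have hd0 : ∀ i, 0 ≤ d i := fun i => by rcases hd i with h | h <;> simp [h]
  have hfun : (fun z : Fin n → ℝ =>
      exp (-(t * ∑ i, d i * z i ^ 2)) * ∏ i, gaussianPDFReal 0 1 (z i))
      = fun z => ∏ j, f j (z j) := by
    funext z
    simp only [f]
    rw [Finset.prod_mul_distrib, ← exp_sum, Finset.mul_sum, Finset.sum_neg_distrib]
    simp only [mul_assoc]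
  have hf := fun j => integral_exp_neg_mul_sq_mul_gaussianPDFReal (mul_nonneg ht (hd0 j))
  have h1 : (0 : ℝ) < 1 + 2 * t := by positivity
  rw [hfun, volume_pi]
  refine ⟨Integrable.fintype_prod fun j => (hf j).1, ?_⟩
  rw [integral_fintype_prod_eq_prod, ← Finset.sum_neg_distrib, Finset.sum_div,
    rpow_sum_of_pos h1]
  refine Finset.prod_congr rfl fun j _ => (hf j).2.trans ?_
  rcases hd j with h | h <;> simp [h]

/-- The expectation of `1 / q` from the Laplace transform of `q`. -/
theorem integral_div_of_laplace {α : Type*} [MeasurableSpace α] {μ : Measure α} [SFinite μ]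
    {w q : α → ℝ} (hw : ∀ x, 0 ≤ w x) (hwm : Measurable w) (hq : ∀ x, 0 ≤ q x)
    (hqm : Measurable q) {c k : ℝ} (hc : 0 < c) (hk : 1 < k)
    (hL : ∀ t, 0 < t → Integrable (fun x => exp (-(t * q x)) * w x) μ ∧
      ∫ x, exp (-(t * q x)) * w x ∂μ = (1 + c * t) ^ (-k)) :
    Integrable (fun x => (q x)⁻¹ * w x) μ ∧
      ∫ x, (q x)⁻¹ * w x ∂μ = (c * (k - 1))⁻¹ := by
  have hderiv : ∀ t ∈ Set.Ici (0 : ℝ),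
      HasDerivAt (fun t => -(c * (k - 1))⁻¹ * (1 + c * t) ^ (-k + 1)) ((1 + c * t) ^ (-k)) t := by
    intro t ht
    have h1 : 0 < 1 + c * t := by
      have : 0 ≤ c * t := mul_nonneg hc.le ht
      linarith
    have h2 : HasDerivAt (fun t => 1 + c * t) c t := by
      simpa using ((hasDerivAt_id t).const_mul c).const_add 1
    have h3 := (h2.rpow_const (p := -k + 1) (Or.inl h1.ne')).const_mul (-(c * (k - 1))⁻¹)
    refine h3.congr_deriv ?_
    have : k - 1 ≠ 0 := by linarith
    rw [add_sub_cancel_right]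
    field_simp
    ring
  have hlim : Tendsto (fun t => -(c * (k - 1))⁻¹ * (1 + c * t) ^ (-k + 1)) atTop (nhds 0) := by
    have h1 : Tendsto (fun t => 1 + c * t) atTop atTop :=
      tendsto_atTop_add_const_left _ _ (tendsto_id.const_mul_atTop hc)
    have h2 := (tendsto_rpow_neg_atTop (y := k - 1) (by linarith)).comp h1
    have h3 := h2.const_mul (-(c * (k - 1))⁻¹)
    simpa [Function.comp_def, neg_add_eq_sub] using h3
  have hpos : ∀ t ∈ Set.Ioi (0 : ℝ), 0 ≤ (1 + c * t) ^ (-k) := fun t ht =>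
    rpow_nonneg (by have := mul_pos hc ht; linarith) _
  have hRint : IntegrableOn (fun t => (1 + c * t) ^ (-k)) (Set.Ioi 0) :=
    integrableOn_Ioi_deriv_of_nonneg' hderiv hpos hlim
  have hRval : ∫ t in Set.Ioi (0 : ℝ), (1 + c * t) ^ (-k) = (c * (k - 1))⁻¹ := by
    rw [integral_Ioi_of_hasDerivAt_of_nonneg' hderiv hpos hlim]
    simp
  have hprod : Integrable (Function.uncurry fun x t => exp (-(t * q x)) * w x)
      (μ.prod (volume.restrict (Set.Ioi (0 : ℝ)))) := by
    have hm : Measurable (Function.uncurry fun (x : α) (t : ℝ) => exp (-(t * q x)) * w x) := by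
      simp only [Function.uncurry_def]
      fun_prop
    rw [integrable_prod_iff' hm.aestronglyMeasurable]
    constructor
    · filter_upwards [ae_restrict_mem measurableSet_Ioi] with t ht using (hL t ht).1
    · refine hRint.congr ?_
      filter_upwards [ae_restrict_mem measurableSet_Ioi] with t ht
      rw [← (hL t ht).2]
      refine integral_congr_ae (ae_of_all _ fun x => ?_)
      simp only [Function.uncurry_apply_pair]
      rw [norm_of_nonneg (mul_nonneg (exp_pos _).le (hw x))]
  have hinner : (fun x => ∫ t in Set.Ioi (0 : ℝ), exp (-(t * q x)) * w x)
      = fun x => (q x)⁻¹ * w x := by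
    funext x
    rw [integral_mul_const]
    congr 1
    rcases (hq x).eq_or_lt with h | h
    · simp [← h, measureReal_def]
    · have := integral_exp_mul_Ioi (neg_lt_zero.mpr h) 0
      simp only [mul_zero, exp_zero] at this
      rw [show (q x)⁻¹ = -1 / -q x by field_simp, ← this]
      congr 1
      funext t
      ring_nf
  have hint := hprod.integral_prod_left
  simp only [Function.uncurry_apply_pair] at hint
  rw [hinner] at hint
  refine ⟨hint, ?_⟩
  rw [← hRval, ← hinner, integral_integral_swap hprod]
  exact setIntegral_congr_fun measurableSet_Ioi fun t ht => (hL t ht).2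

theorem Matrix.PosDef.gaussPdf_nonneg {n : ℕ} (μ : Fin n → ℝ) {S : Matrix (Fin n) (Fin n) ℝ}
    (hS : S.PosDef) (x : Fin n → ℝ) : 0 ≤ gaussPdf μ S x := by
  have := hS.det_pos
  unfold gaussPdf
  positivity

theorem continuous_gaussPdf {n : ℕ} (μ : Fin n → ℝ) (S : Matrix (Fin n) (Fin n) ℝ) :
    Continuous (gaussPdf μ S) := by
  unfold gaussPdf
  fun_prop

theorem ae_dotProduct_mulVec_pos {n : ℕ} {V P : Matrix (Fin n) (Fin n) ℝ} (hV : V.PosDef)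
    (hPt : Pᵀ = P) (hPVP : P * V * P = P) (hP0 : P ≠ 0) :
    (∀ y, 0 ≤ y ⬝ᵥ P *ᵥ y) ∧ ∀ᵐ y : Fin n → ℝ, 0 < y ⬝ᵥ P *ᵥ y := by
  have hq : ∀ y, y ⬝ᵥ P *ᵥ y = (P *ᵥ y) ⬝ᵥ V *ᵥ (P *ᵥ y) := by
    intro y
    conv_lhs => rw [← hPVP]
    rw [← mulVec_mulVec, ← mulVec_mulVec, dotProduct_mulVec, ← mulVec_transpose, hPt]
  have hnn : ∀ y, 0 ≤ y ⬝ᵥ P *ᵥ y := fun y => by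
    rw [hq]
    simpa using hV.posSemidef.dotProduct_mulVec_nonneg (P *ᵥ y)
  refine ⟨hnn, ?_⟩
  have hker : LinearMap.ker P.mulVecLin ≠ ⊤ := fun h => by
    rw [LinearMap.ker_eq_top, ← toLin'_apply'] at h
    exact hP0 ((LinearEquiv.map_eq_zero_iff toLin').mp h)
  have hnull := Measure.addHaar_submodule (volume : Measure (Fin n → ℝ)) _ hker
  filter_upwards [measure_eq_zero_iff_ae_notMem.mp hnull] with y hy
  have hPy : P *ᵥ y ≠ 0 := fun h => hy (by simpa using h)
  rw [hq]
  simpa using hV.dotProduct_mulVec_pos hPy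

theorem Real.abs_log_le_add_inv {x : ℝ} (hx : 0 ≤ x) : |log x| ≤ x + x⁻¹ := by
  have h1 := log_le_self hx
  have h2 := log_le_self (inv_nonneg.mpr hx)
  rw [log_inv] at h2
  have h3 := inv_nonneg.mpr hx
  exact abs_le.mpr ⟨by linarith, by linarith⟩

/-- Mean and inverse mean of the residual quadratic form, with the integrability needed to
use them. -/
theorem residual_moments {n p : ℕ} (hnp : p + 2 < n) {X : Matrix (Fin n) (Fin p) ℝ}
    (hX : X.rank = p) (β : Fin p → ℝ) {V : Matrix (Fin n) (Fin n) ℝ}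
    (hV : V.PosDef) {σ2 : ℝ} (hσ : 0 < σ2) {P : Matrix (Fin n) (Fin n) ℝ}
    (hP : P = V⁻¹ - V⁻¹ * X * (Xᵀ * V⁻¹ * X)⁻¹ * Xᵀ * V⁻¹) :
    (Integrable (gaussPdf (X *ᵥ β) (σ2 • V)) ∧ ∫ y, gaussPdf (X *ᵥ β) (σ2 • V) y = 1) ∧
    (Integrable (fun y => (y ⬝ᵥ P *ᵥ y) * gaussPdf (X *ᵥ β) (σ2 • V) y) ∧
      ∫ y, (y ⬝ᵥ P *ᵥ y) * gaussPdf (X *ᵥ β) (σ2 • V) y = σ2 * ((n : ℝ) - p)) ∧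
    (Integrable (fun y => (y ⬝ᵥ P *ᵥ y)⁻¹ * gaussPdf (X *ᵥ β) (σ2 • V) y) ∧
      ∫ y, (y ⬝ᵥ P *ᵥ y)⁻¹ * gaussPdf (X *ᵥ β) (σ2 • V) y = (σ2 * ((n : ℝ) - p - 2))⁻¹) ∧
    (∀ y, 0 ≤ y ⬝ᵥ P *ᵥ y) ∧ ∀ᵐ y : Fin n → ℝ, 0 < y ⬝ᵥ P *ᵥ y := by
  have hm : (2 : ℝ) < (n : ℝ) - p := by
    have : (p : ℝ) + 2 < n := by exact_mod_cast hnp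
    linarith
  obtain ⟨hPt, hPVP, hPX, htr⟩ := residual_projection_properties hX hV hP
  obtain ⟨B, d, hB, hBP, hd, hsum⟩ := exists_simultaneous_diagonalization hV hPt hPVP
  rw [htr] at hsum
  have hP0 : P ≠ 0 := by
    rintro rfl
    rw [Matrix.zero_mul, trace_zero] at htr
    linarith
  obtain ⟨hnn, hpos⟩ := ae_dotProduct_mulVec_pos hV hPt hPVP hP0
  have hσs : √σ2 * √σ2 = σ2 := mul_self_sqrt hσ.le
  set C := √σ2 • B with hCdef
  have hS : σ2 • V = C * Cᵀ := by
    rw [hCdef, transpose_smul, Matrix.smul_mul, Matrix.mul_smul, smul_smul, hσs, hB]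
  have hSp : (σ2 • V).PosDef := hV.smul hσ
  have hC : C.det ≠ 0 := fun h => by
    have := hSp.det_pos
    rw [hS, det_mul, h, zero_mul] at this
    exact lt_irrefl _ this
  have hq : ∀ z, (C *ᵥ z + X *ᵥ β) ⬝ᵥ P *ᵥ (C *ᵥ z + X *ᵥ β) = σ2 * ∑ i, d i * z i ^ 2 := by
    intro z
    have hCP : Cᵀ * P * C = σ2 • diagonal d := by
      rw [hCdef, transpose_smul, Matrix.smul_mul, Matrix.smul_mul, Matrix.mul_smul, smul_smul, hσs,
        hBP]
    have h1 : P *ᵥ (C *ᵥ z + X *ᵥ β) = P *ᵥ (C *ᵥ z) := by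
      rw [mulVec_add, mulVec_mulVec _ P X, hPX, zero_mulVec, add_zero]
    have h2 : (X *ᵥ β) ⬝ᵥ P *ᵥ (C *ᵥ z) = 0 := by
      rw [dotProduct_mulVec, ← mulVec_transpose, hPt, mulVec_mulVec, hPX, zero_mulVec,
        zero_dotProduct]
    have h3 : (C *ᵥ z) ⬝ᵥ P *ᵥ (C *ᵥ z) = z ⬝ᵥ (Cᵀ * P * C) *ᵥ z := by
      rw [← mulVec_mulVec, ← mulVec_mulVec, dotProduct_mulVec z, vecMul_transpose]
    rw [h1, add_dotProduct, h2, add_zero, h3, hCP, smul_mulVec, dotProduct_smul, smul_eq_mul]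
    congr 1
    simp only [dotProduct, mulVec_diagonal]
    exact Finset.sum_congr rfl fun i _ => by ring
  set w := gaussPdf (X *ᵥ β) (σ2 • V) with hw
  have hL : ∀ t : ℝ, 0 ≤ t → Integrable (fun y => exp (-(t * (y ⬝ᵥ P *ᵥ y))) * w y) ∧
      ∫ y, exp (-(t * (y ⬝ᵥ P *ᵥ y))) * w y = (1 + 2 * σ2 * t) ^ (-(((n : ℝ) - p) / 2)) := by
    intro t ht
    have h1 := integral_mul_gaussPdf (X *ᵥ β) hS hC (fun y => exp (-(t * (y ⬝ᵥ P *ᵥ y))))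
    have h2 := integral_exp_neg_mul_prod_gaussianPDFReal hd (mul_nonneg ht hσ.le)
    simp only [hq, ← mul_assoc t σ2] at h1
    rw [hsum, show 2 * (t * σ2) = 2 * σ2 * t by ring, neg_div] at h2
    exact ⟨h1.1 h2.1, h1.2.trans h2.2⟩
  have hqc : Continuous fun y : Fin n → ℝ => y ⬝ᵥ P *ᵥ y := by fun_prop
  refine ⟨?_, ?_, ?_, hnn, hpos⟩
  · simpa using hL 0 le_rfl
  · have h1 := integral_mul_gaussPdf (X *ᵥ β) hS hC (fun y => y ⬝ᵥ P *ᵥ y)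
    have h2 := integral_weighted_sq_mul_prod_gaussianPDFReal d
    simp only [hq, mul_assoc] at h1
    refine ⟨h1.1 (h2.1.const_mul σ2), h1.2.trans ?_⟩
    rw [integral_const_mul, h2.2, hsum]
  · have h := integral_div_of_laplace (μ := volume) (hSp.gaussPdf_nonneg (X *ᵥ β))
      (continuous_gaussPdf _ _).measurable hnn hqc.measurable (c := 2 * σ2)
      (k := ((n : ℝ) - p) / 2) (by positivity) (by linarith) (fun t ht => hL t ht.le)
    rwa [show 2 * σ2 * (((n : ℝ) - p) / 2 - 1) = σ2 * ((n : ℝ) - p - 2) by ring] at h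

/-- Proposition 2: with the REML estimator `σ̃² = yᵀPy/(n-p)`, the criterion
`IC_r = -2 log f_r(y|σ̃²) + 2(n-p)/(n-p-2)` is an unbiased estimator of
`I_r(ω) = E[-2 log f_r(ỹ|σ̃²)]`, where `y, ỹ` are independent copies from
`N_n(Xβ, σ²V)`; equivalently `E[ỹᵀPỹ/σ̃²] - (n-p) = 2(n-p)/(n-p-2)`. -/
theorem stmt_9 (n p : ℕ) (hnp : p + 2 < n) (X : Matrix (Fin n) (Fin p) ℝ)
    (hX : X.rank = p) (β : Fin p → ℝ) (V : Matrix (Fin n) (Fin n) ℝ)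
    (hV : V.PosDef) (σ2 : ℝ) (hσ : 0 < σ2)
    (P : Matrix (Fin n) (Fin n) ℝ)
    (hP : P = V⁻¹ - V⁻¹ * X * (Xᵀ * V⁻¹ * X)⁻¹ * Xᵀ * V⁻¹) :
    ((∫ y : Fin n → ℝ,
        (neg2logResid n p X V P (y ⬝ᵥ P.mulVec y / ((n : ℝ) - p)) y
            + 2 * ((n : ℝ) - p) / ((n : ℝ) - p - 2))
          * gaussPdf (X.mulVec β) (σ2 • V) y)
      = ∫ y : Fin n → ℝ,
          (∫ ytil : Fin n → ℝ,
            neg2logResid n p X V P (y ⬝ᵥ P.mulVec y / ((n : ℝ) - p)) ytil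
              * gaussPdf (X.mulVec β) (σ2 • V) ytil)
            * gaussPdf (X.mulVec β) (σ2 • V) y) ∧
    ((∫ y : Fin n → ℝ,
        (∫ ytil : Fin n → ℝ,
          ((ytil ⬝ᵥ P.mulVec ytil) / (y ⬝ᵥ P.mulVec y / ((n : ℝ) - p)))
            * gaussPdf (X.mulVec β) (σ2 • V) ytil)
          * gaussPdf (X.mulVec β) (σ2 • V) y)
      - ((n : ℝ) - p)
      = 2 * ((n : ℝ) - p) / ((n : ℝ) - p - 2)) := by
  obtain ⟨⟨hi0, h0⟩, ⟨hi1, h1⟩, ⟨hi2, h2⟩, hnn, hpos⟩ := residual_moments hnp hX β hV hσ hP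
  have hm : (2 : ℝ) < (n : ℝ) - p := by
    have : (p : ℝ) + 2 < n := by exact_mod_cast hnp
    linarith
  have hwc := (continuous_gaussPdf (X *ᵥ β) (σ2 • V)).measurable
  have hw0 := (hV.smul hσ).gaussPdf_nonneg (X *ᵥ β)
  set w := gaussPdf (X *ᵥ β) (σ2 • V)
  set m : ℝ := (n : ℝ) - p with hmdef
  have hm0 : m ≠ 0 := by linarith
  have hm2 : m - 2 ≠ 0 := by linarith
  have hqm : Measurable fun y : Fin n → ℝ => y ⬝ᵥ P *ᵥ y :=
    Continuous.measurable (by fun_prop)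
  have hratio : ∀ s : ℝ, ∫ ytil, (ytil ⬝ᵥ P *ᵥ ytil) / (s / m) * w ytil = σ2 * m ^ 2 * s⁻¹ := by
    intro s
    have : (fun ytil => (ytil ⬝ᵥ P *ᵥ ytil) / (s / m) * w ytil)
        = fun ytil => (m * s⁻¹) * ((ytil ⬝ᵥ P *ᵥ ytil) * w ytil) := by
      funext ytil
      rw [div_div_eq_mul_div, div_eq_mul_inv]
      ring
    rw [this, integral_const_mul, h1]
    ring
  have hratio_int : ∀ s : ℝ, Integrable fun ytil => (ytil ⬝ᵥ P *ᵥ ytil) / (s / m) * w ytil := by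
    intro s
    refine (hi1.const_mul (m * s⁻¹)).congr (ae_of_all _ fun ytil => ?_)
    simp only
    rw [div_div_eq_mul_div, div_eq_mul_inv]
    ring
  have hinv : ∫ y, σ2 * m ^ 2 * (y ⬝ᵥ P *ᵥ y)⁻¹ * w y = m + 2 * m / (m - 2) := by
    simp only [mul_assoc (σ2 * m ^ 2)]
    rw [integral_const_mul, h2]
    field_simp
    ring
  refine ⟨?_, ?_⟩
  · set A : (Fin n → ℝ) → ℝ := fun y => m * log (2 * π * ((y ⬝ᵥ P *ᵥ y) / m)) + log V.det
      + log (Xᵀ * V⁻¹ * X).det with hA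
    have hlog : Integrable fun y => log (2 * π * ((y ⬝ᵥ P *ᵥ y) / m)) * w y := by
      have hdom := (hi1.const_mul (2 * π / m)).add (hi2.const_mul (2 * π / m)⁻¹)
      refine hdom.mono' (by fun_prop) (ae_of_all _ fun y => ?_)
      have hnn' : 0 ≤ 2 * π * ((y ⬝ᵥ P *ᵥ y) / m) :=
        mul_nonneg (by positivity) (div_nonneg (hnn y) (by linarith))
      rw [norm_mul, norm_of_nonneg (hw0 y), norm_eq_abs]
      refine (mul_le_mul_of_nonneg_right (abs_log_le_add_inv hnn') (hw0 y)).trans_eq ?_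
      simp only [Pi.add_apply]
      rw [mul_div_assoc', mul_div_right_comm, mul_inv]
      ring
    have hAint : Integrable fun y => A y * w y := by
      refine ((hlog.const_mul m).add
        (hi0.const_mul (log V.det + log (Xᵀ * V⁻¹ * X).det))).congr (ae_of_all _ fun y => ?_)
      simp only [hA, Pi.add_apply]
      ring
    have hrhs : ∀ y, ∫ ytil, neg2logResid n p X V P ((y ⬝ᵥ P *ᵥ y) / m) ytil * w ytil
        = A y + σ2 * m ^ 2 * (y ⬝ᵥ P *ᵥ y)⁻¹ := by
      intro y
      have : (fun ytil => neg2logResid n p X V P ((y ⬝ᵥ P *ᵥ y) / m) ytil * w ytil)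
          = fun ytil => A y * w ytil
            + (ytil ⬝ᵥ P *ᵥ ytil) / ((y ⬝ᵥ P *ᵥ y) / m) * w ytil := by
        funext ytil
        simp only [neg2logResid, hA, ← hmdef]
        ring
      rw [this, integral_add (hi0.const_mul _) (hratio_int _), integral_const_mul, h0, mul_one,
        hratio]
    have hlhs : (fun y => (neg2logResid n p X V P ((y ⬝ᵥ P *ᵥ y) / m) y + 2 * m / (m - 2)) * w y)
        =ᵐ[volume] fun y => A y * w y + (m + 2 * m / (m - 2)) * w y := by
      filter_upwards [hpos] with y hy
      have hcancel : (y ⬝ᵥ P *ᵥ y) / ((y ⬝ᵥ P *ᵥ y) / m) = m := by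
        field_simp
      simp only [neg2logResid, hA, ← hmdef, hcancel]
      ring
    have hinvint : Integrable fun y => σ2 * m ^ 2 * (y ⬝ᵥ P *ᵥ y)⁻¹ * w y := by
      simpa only [mul_assoc (σ2 * m ^ 2)] using hi2.const_mul (σ2 * m ^ 2)
    rw [integral_congr_ae hlhs, integral_add hAint (hi0.const_mul _), integral_const_mul, h0,
      mul_one]
    simp only [hrhs, add_mul]
    rw [integral_add hAint hinvint, hinv]
  · simp only [hratio]
    rw [hinv]
    ring
end

section
/- Let (X_n) be a sequence of n×p design matrices and W a fixed p×p positive definite matrix, and suppose n^{−1} X_n^t V_n^{−1} X_n converges to a p×p positive definite matrix as n → ∞, where V_n are n×n positive definite matrices. Then tr[ (X_n^t V_n^{−1} X_n + W^{−1})^{−1} W^{−1} ] → 0 and tr[ X_n^t V_n^{−1} X_n (X_n^t V_n^{−1} X_n + W^{−1})^{−1} ] → p as n → ∞. -/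
open Matrix Filter Topology

/-- If `n⁻¹ • A n` tends to an invertible matrix, then `(A n + B)⁻¹` tends to `0`,
and `A n + B` is eventually invertible. -/
theorem tendsto_inv_add_of_tendsto_inv_smul {ι : Type*} [Fintype ι] [DecidableEq ι]
    {A : ℕ → Matrix ι ι ℝ} {L : Matrix ι ι ℝ} (B : Matrix ι ι ℝ) (hL : IsUnit L.det)
    (h : Tendsto (fun n : ℕ => (n : ℝ)⁻¹ • A n) atTop (𝓝 L)) :
    Tendsto (fun n => (A n + B)⁻¹) atTop (𝓝 0) ∧ ∀ᶠ n in atTop, IsUnit (A n + B).det := by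
  have hinv : Tendsto (fun n : ℕ => (n : ℝ)⁻¹) atTop (𝓝 0) :=
    tendsto_inv_atTop_nhds_zero_nat
  have hsum : Tendsto (fun n : ℕ => (n : ℝ)⁻¹ • (A n + B)) atTop (𝓝 L) := by
    simpa [smul_add] using h.add (hinv.smul_const B)
  have hdet : ∀ᶠ n : ℕ in atTop, ((n : ℝ)⁻¹ • (A n + B)).det ≠ 0 :=
    ((continuous_id.matrix_det.tendsto L).comp hsum).eventually_ne hL.ne_zero
  have hunit : ∀ᶠ n : ℕ in atTop, IsUnit (A n + B).det := by
    filter_upwards [hdet] with n hn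
    rw [det_smul] at hn
    exact (right_ne_zero_of_mul hn).isUnit
  refine ⟨?_, hunit⟩
  have hcont : ContinuousAt (fun M : Matrix ι ι ℝ => M⁻¹) L := by
    refine continuousAt_matrix_inv L ?_
    rw [Ring.inverse_eq_inv']
    exact continuousAt_inv₀ hL.ne_zero
  have hlim := hinv.smul (hcont.tendsto.comp hsum)
  rw [zero_smul] at hlim
  refine hlim.congr' ?_
  filter_upwards [hunit, eventually_gt_atTop 0] with n hn hpos
  have hn0 : (n : ℝ)⁻¹ ≠ 0 := by positivity
  have key := Matrix.inv_smul' (A n + B) (Units.mk0 _ hn0) hn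
  simp only [Units.smul_def, Units.val_mk0, Units.val_inv_eq_inv_val] at key
  simp only [Function.comp_apply, key, smul_smul, mul_inv_cancel₀ hn0, one_smul]

/-- If `n⁻¹ Xₙᵀ Vₙ⁻¹ Xₙ` converges to a positive definite `p × p` matrix `L` as
`n → ∞` (with `W` a fixed positive definite `p × p` matrix and `Vₙ` positive
definite), then `tr[(XₙᵀVₙ⁻¹Xₙ + W⁻¹)⁻¹ W⁻¹] → 0` and
`tr[XₙᵀVₙ⁻¹Xₙ (XₙᵀVₙ⁻¹Xₙ + W⁻¹)⁻¹] → p`. -/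
theorem stmt_13 (p : ℕ) (X : (n : ℕ) → Matrix (Fin n) (Fin p) ℝ)
    (V : (n : ℕ) → Matrix (Fin n) (Fin n) ℝ) (hV : ∀ n, (V n).PosDef)
    (W : Matrix (Fin p) (Fin p) ℝ) (hW : W.PosDef)
    (L : Matrix (Fin p) (Fin p) ℝ) (hL : L.PosDef)
    (hconv : Tendsto (fun n : ℕ => (n : ℝ)⁻¹ • ((X n)ᵀ * (V n)⁻¹ * X n))
      atTop (𝓝 L)) :
    Tendsto (fun n : ℕ => (((X n)ᵀ * (V n)⁻¹ * X n + W⁻¹)⁻¹ * W⁻¹).trace)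
        atTop (𝓝 0) ∧
    Tendsto (fun n : ℕ =>
        ((X n)ᵀ * (V n)⁻¹ * X n * ((X n)ᵀ * (V n)⁻¹ * X n + W⁻¹)⁻¹).trace)
      atTop (𝓝 (p : ℝ)) := by
  obtain ⟨hlim, hunit⟩ :=
    tendsto_inv_add_of_tendsto_inv_smul W⁻¹ hL.det_pos.ne'.isUnit hconv
  have htrace : Tendsto (fun n : ℕ => (((X n)ᵀ * (V n)⁻¹ * X n + W⁻¹)⁻¹ * W⁻¹).trace)
      atTop (𝓝 0) := by
    have hc : Continuous fun M : Matrix (Fin p) (Fin p) ℝ => (M * W⁻¹).trace := by fun_prop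
    have h0 := (hc.tendsto 0).comp hlim
    rw [zero_mul, trace_zero] at h0
    exact h0
  refine ⟨htrace, ?_⟩
  have hsub := htrace.const_sub (p : ℝ)
  rw [sub_zero] at hsub
  refine hsub.congr' ?_
  filter_upwards [hunit] with n hn
  have key := congrArg trace (mul_nonsing_inv _ hn)
  rw [add_mul, trace_add, trace_mul_comm W⁻¹, trace_one, Fintype.card_fin] at key
  linarith
end
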